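/- arXiv:0901.0752 — 2 statements merged into one kernel-verified Lean document; each statement's English description precedes it below -/
import Mathlib

section
/- Let X be a complex Banach space and T a bounded linear operator on X that has no eigenvectors (i.e., there is no λ ∈ ℂ and nonzero x ∈ X with Tx = λx). Then for any nonzero vector e ∈ X, the family {h(λ,e) : λ ∈ ρ(T)⁻¹} is linearly independent. -/
variable {X : Type*} [NormedAddCommGroup X] [NormedSpace ℂ X]

/-- For `λ ∈ ρ(T)⁻¹`, the vector `h(λ,e) = (λ⁻¹ I − T)⁻¹ e`. -/
noncomputable def hVec (T : X →L[ℂ] X) (l : ℂ) (e : X) : X :=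
  (Ring.inverse (algebraMap ℂ (X →L[ℂ] X) l⁻¹ - T)) e

open Polynomial in
/-- Over an algebraically closed field, a nonzero polynomial in an endomorphism without
eigenvectors is injective. -/
theorem eq_zero_of_aeval_apply_eq_zero {K V : Type*} [Field K] [IsAlgClosed K] [AddCommGroup V]
    [Module K V] {f : Module.End K V} (hf : ∀ (l : K) (x : V), f x = l • x → x = 0)
    {p : K[X]} (hp : p ≠ 0) {x : V} (hx : aeval f p x = 0) : x = 0 := by
  have hprod : ∀ (s : Multiset K) (y : V),
      aeval f (s.map fun a => X - C a).prod y = 0 → y = 0 := by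
    intro s
    induction s using Multiset.induction_on with
    | empty => intro y hy; simpa using hy
    | cons a s ih =>
      intro y hy
      rw [Multiset.map_cons, Multiset.prod_cons, map_mul, Module.End.mul_apply] at hy
      refine ih y (hf a _ (sub_eq_zero.mp ?_))
      simpa [Module.algebraMap_end_apply] using hy
  rw [(IsAlgClosed.splits p).eq_prod_roots, map_mul, aeval_C, Module.End.mul_apply,
    Module.algebraMap_end_apply, smul_eq_zero] at hx
  exact hprod _ _ (hx.resolve_left (leadingCoeff_ne_zero.mpr hp))

open Polynomial in
/-- If `f` has no eigenvectors, preimages of a fixed nonzero vector under the operators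
`μ i - f`, for distinct scalars `μ i`, are linearly independent. -/
theorem linearIndependent_of_smul_sub_apply_eq {ι K V : Type*} [Field K] [IsAlgClosed K]
    [AddCommGroup V] [Module K V] {f : Module.End K V}
    (hf : ∀ (l : K) (x : V), f x = l • x → x = 0) {e : V} (he : e ≠ 0) {μ : ι → K}
    (hμ : Function.Injective μ) {v : ι → V} (hv : ∀ i, μ i • v i - f (v i) = e) :
    LinearIndependent K v := by
  classical
  rw [linearIndependent_iff']
  intro s c hc i hi
  set q : K[X] := ∑ j ∈ s, C (c j) * ∏ k ∈ s.erase j, (C (μ k) - X) with hq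
  have hqe : aeval f q e = 0 := by
    have key : ∀ j ∈ s, aeval f (C (c j) * ∏ k ∈ s.erase j, (C (μ k) - X)) e =
        aeval f (∏ k ∈ s, (C (μ k) - X)) (c j • v j) := by
      intro j hj
      have hej : aeval f (C (μ j) - X) (v j) = e := by
        simpa [Module.algebraMap_end_apply] using hv j
      rw [← Finset.prod_erase_mul s _ hj, map_mul, map_mul, Module.End.mul_apply,
        Module.End.mul_apply, map_smul, map_smul, hej, aeval_C, Module.algebraMap_end_apply]
    rw [hq, map_sum, LinearMap.sum_apply, Finset.sum_congr rfl key, ← map_sum, hc, map_zero]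
  have hq0 : q = 0 := by
    by_contra h
    exact he (eq_zero_of_aeval_apply_eq_zero hf h hqe)
  have hev : q.eval (μ i) = c i * ∏ k ∈ s.erase i, (μ k - μ i) := by
    rw [hq, eval_finsetSum, Finset.sum_eq_single_of_mem i hi]
    · simp [eval_prod]
    · intro j _ hji
      rw [eval_mul, eval_prod,
        Finset.prod_eq_zero (Finset.mem_erase.mpr ⟨hji.symm, hi⟩) (by simp), mul_zero]
  rw [hq0, eval_zero, eq_comm, mul_eq_zero] at hev
  refine hev.resolve_right (Finset.prod_ne_zero_iff.mpr fun k hk => sub_ne_zero.mpr ?_)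
  exact hμ.ne (Finset.ne_of_mem_erase hk)

/-- If `T` has no eigenvectors, then for every nonzero `e` the family
`{h(λ,e) : λ ∈ ρ(T)⁻¹}` is linearly independent. -/
theorem hVec_linearIndependent [CompleteSpace X] (T : X →L[ℂ] X)
    (hT : ∀ (l : ℂ) (x : X), T x = l • x → x = 0)
    (e : X) (he : e ≠ 0) :
    LinearIndependent ℂ
      (fun l : {l : ℂ // l ≠ 0 ∧ l⁻¹ ∈ resolventSet ℂ T} => hVec T (l : ℂ) e) := by
  refine linearIndependent_of_smul_sub_apply_eq (f := (T : X →ₗ[ℂ] X)) hT he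
    (μ := fun l : {l : ℂ // l ≠ 0 ∧ l⁻¹ ∈ resolventSet ℂ T} => (l : ℂ)⁻¹)
    (inv_injective.comp Subtype.val_injective) fun l => ?_
  have h := congrArg (fun S : X →L[ℂ] X => S e) (Ring.mul_inverse_cancel _ l.2.2)
  simpa [hVec, Algebra.algebraMap_eq_smul_one] using h
end

section
/- Let 1 ≤ p < ∞, let X = ℓ_p, let x = (1, 1, 1/2!, 1/3!, 1/4!, …) ∈ X (i.e., x_0 = 1 and x_n = 1/n! for n ≥ 1), let S be the backward shift operator on X, and set x_n = Sⁿx. Then for every strictly increasing sequence (n_k) of natural numbers, the closed linear span of the subsequence (x_{n_k}) is all of X. -/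
open scoped ENNReal

theorem Nat.succ_mul_factorial_mul_factorial_le (n m i : ℕ) :
    (n + 1) * (n + m).factorial * (m + i + 1).factorial
      ≤ (m + 1).factorial * (n + m + i + 1).factorial := by
  induction i with
  | zero =>
    have h : (n + 1) * (n + m).factorial ≤ (n + m + 1).factorial := by
      rw [Nat.factorial_succ]
      gcongr
      omega
    simpa [mul_comm] using Nat.mul_le_mul_right (m + 1).factorial h
  | succ i ih =>
    calc (n + 1) * (n + m).factorial * (m + (i + 1) + 1).factorial
        = (m + i + 2) * ((n + 1) * (n + m).factorial * (m + i + 1).factorial) := by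
          rw [← add_assoc m i 1, Nat.factorial_succ (m + i + 1)]; ring
      _ ≤ (n + m + i + 2) * ((m + 1).factorial * (n + m + i + 1).factorial) := by
          gcongr
          omega
      _ = (m + 1).factorial * (n + m + (i + 1) + 1).factorial := by
          rw [← add_assoc (n + m) i 1, Nat.factorial_succ (n + m + i + 1)]; ring

theorem backwardShift_pow_apply {p : ℝ≥0∞} [Fact (1 ≤ p)]
    {S : lp (fun _ : ℕ => ℂ) p →L[ℂ] lp (fun _ : ℕ => ℂ) p}
    (hS : ∀ (a : lp (fun _ : ℕ => ℂ) p) (n : ℕ), (S a : ℕ → ℂ) n = (a : ℕ → ℂ) (n + 1))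
    (a : lp (fun _ : ℕ => ℂ) p) (n j : ℕ) :
    ((S ^ n) a : ℕ → ℂ) j = (a : ℕ → ℂ) (n + j) := by
  induction n generalizing j with
  | zero => simp
  | succ n ih =>
    rw [pow_succ', mul_apply_eq_comp, hS, ih, add_right_comm, add_assoc]

/-- Once its first `m` coordinates are removed, the `n`-th shift of `(1 / j!)`, scaled by
`(n + m)!`, is within `O(1 / n)` of the `m`-th unit vector. -/
theorem norm_factorial_smul_truncated_shift_sub_single_le {p : ℝ≥0∞} [Fact (1 ≤ p)]
    {x y : lp (fun _ : ℕ => ℂ) p} {n : ℕ}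
    (hx : ∀ j : ℕ, (x : ℕ → ℂ) j = 1 / (j.factorial : ℂ))
    (hy : ∀ j : ℕ, (y : ℕ → ℂ) j = 1 / ((n + j).factorial : ℂ)) (m : ℕ) :
    ‖((n + m).factorial : ℂ) •
          (y - ∑ j ∈ Finset.range m, lp.single p j ((y : ℕ → ℂ) j)) - lp.single p m (1 : ℂ)‖
      ≤ (m + 1).factorial * ‖x‖ * (1 / ((n : ℝ) + 1)) := by
  have hp0 : p ≠ 0 := (zero_lt_one.trans_le Fact.out).ne'
  have hn : ‖(n : ℂ) + 1‖ = (n : ℝ) + 1 := by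
    exact_mod_cast Complex.norm_natCast (n + 1)
  have hnorm : ‖(((m + 1).factorial : ℂ) / ((n : ℂ) + 1)) • x‖
      = (m + 1).factorial * ‖x‖ * (1 / ((n : ℝ) + 1)) := by
    rw [norm_smul, norm_div, hn, Complex.norm_natCast]
    ring
  rw [← hnorm]
  refine lp.norm_mono hp0 fun j => ?_
  have hsum : ((∑ i ∈ Finset.range m, lp.single p i ((y : ℕ → ℂ) i) :
      lp (fun _ : ℕ => ℂ) p) : ℕ → ℂ) j = if j < m then (y : ℕ → ℂ) j else 0 := by
    rw [lp.coeFn_sum, Finset.sum_apply]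
    simp [Pi.single_apply]
  simp only [lp.coeFn_sub, lp.coeFn_smul, Pi.sub_apply, Pi.smul_apply, smul_eq_mul, hsum,
    lp.coeFn_single]
  rcases lt_trichotomy j m with h | rfl | h
  · simp only [h, if_true, sub_self, mul_zero, Pi.single_eq_of_ne h.ne, norm_zero]
    exact norm_nonneg _
  · have hne : ((n + j).factorial : ℂ) ≠ 0 := by exact_mod_cast (n + j).factorial_ne_zero
    simp only [lt_irrefl, if_false, sub_zero, Pi.single_eq_same, hy, mul_one_div_cancel hne,
      sub_self, norm_zero]
    exact norm_nonneg _
  · obtain ⟨i, rfl⟩ := Nat.exists_eq_add_of_lt h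
    have hle : ((n : ℝ) + 1) * (n + m).factorial * (m + i + 1).factorial
        ≤ (m + 1).factorial * (n + m + i + 1).factorial := by
      exact_mod_cast Nat.succ_mul_factorial_mul_factorial_le n m i
    simp only [h.not_gt, if_false, sub_zero, Pi.single_eq_of_ne h.ne', hx, hy, norm_mul,
      norm_div, Complex.norm_natCast, norm_one, hn]
    rw [mul_one_div, div_mul_div_comm, mul_one, div_le_div_iff₀ (by positivity) (by positivity),
      show n + (m + i + 1) = n + m + i + 1 by ring]
    linarith

/-- For `x = (1, 1, 1/2!, 1/3!, …) ∈ ℓ_p` (`1 ≤ p < ∞`) and `S` the backward shift,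
the closed linear span of every subsequence of `(Sⁿx)` is all of `ℓ_p`. -/
theorem closedSpan_subsequence_backwardShift_orbit_eq_top
    (p : ℝ≥0∞) [Fact (1 ≤ p)] (hp : p ≠ ∞)
    (S : lp (fun _ : ℕ => ℂ) p →L[ℂ] lp (fun _ : ℕ => ℂ) p)
    (hS : ∀ (a : lp (fun _ : ℕ => ℂ) p) (n : ℕ), (S a : ℕ → ℂ) n = (a : ℕ → ℂ) (n + 1))
    (x : lp (fun _ : ℕ => ℂ) p)
    (hx : ∀ n : ℕ, (x : ℕ → ℂ) n = 1 / (n.factorial : ℂ))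
    (nk : ℕ → ℕ) (hnk : StrictMono nk) :
    (Submodule.span ℂ (Set.range fun k => (S ^ nk k) x)).topologicalClosure = ⊤ := by
  set V := (Submodule.span ℂ (Set.range fun k => (S ^ nk k) x)).topologicalClosure with hV
  have hclosed : IsClosed (V : Set (lp (fun _ : ℕ => ℂ) p)) :=
    Submodule.isClosed_topologicalClosure _
  have hmem (k : ℕ) : (S ^ nk k) x ∈ V :=
    Submodule.le_topologicalClosure _ (Submodule.subset_span ⟨k, rfl⟩)
  have hsmul (i : ℕ) (c : ℂ) (h : lp.single p i (1 : ℂ) ∈ V) :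
      (lp.single p i c : lp (fun _ : ℕ => ℂ) p) ∈ V := by
    have := V.smul_mem c h
    rwa [← lp.single_smul, smul_eq_mul, mul_one] at this
  have hsingle (m : ℕ) : (lp.single p m (1 : ℂ) : lp (fun _ : ℕ => ℂ) p) ∈ V := by
    induction m using Nat.strong_induction_on with
    | _ m ih =>
      have hlim : Filter.Tendsto (fun k => ((nk k + m).factorial : ℂ) • ((S ^ nk k) x -
          ∑ j ∈ Finset.range m, lp.single p j (((S ^ nk k) x : ℕ → ℂ) j)))
          Filter.atTop (nhds (lp.single p m (1 : ℂ) : lp (fun _ : ℕ => ℂ) p)) := by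
        rw [tendsto_iff_norm_sub_tendsto_zero]
        have h0 := ((tendsto_one_div_add_atTop_nhds_zero_nat (𝕜 := ℝ)).comp
          hnk.tendsto_atTop).const_mul ((m + 1).factorial * ‖x‖)
        rw [mul_zero] at h0
        refine squeeze_zero (fun _ => norm_nonneg _) (fun k => ?_) h0
        exact norm_factorial_smul_truncated_shift_sub_single_le hx
          (fun j => by rw [backwardShift_pow_apply hS, hx]) m
      refine hclosed.mem_of_tendsto hlim (Filter.Eventually.of_forall fun k => ?_)
      exact V.smul_mem _ (V.sub_mem (hmem k) (V.sum_mem fun j hj =>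
        hsmul j _ (ih j (Finset.mem_range.mp hj))))
  refine Submodule.eq_top_iff'.mpr fun a => ?_
  exact hclosed.mem_of_tendsto (lp.hasSum_single hp a) (Filter.Eventually.of_forall fun s =>
    V.sum_mem fun i _ => hsmul i _ (hsingle i))
end
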